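/- arXiv:1911.02097 — 2 statements merged into one kernel-verified Lean document; each statement's English description precedes it below -/
import Mathlib

section
/- On ℝ⁶ with coordinates (t,x,y,u,v,h), the three vector fields D(1) = ∂_t, D(t) = t∂_t + ½x∂_x + ½y∂_y − ½u∂_u − ½v∂_v − h∂_h, and D(t²) = t²∂_t + tx∂_x + ty∂_y + (x − tu)∂_u + (y − tv)∂_v − 2th∂_h are linearly independent, their span is closed under the Lie bracket of vector fields with [D(1), D(t)] = D(1), [D(1), D(t²)] = 2D(t), [D(t), D(t²)] = D(t²), and this three-dimensional Lie algebra is isomorphic to sl(2,ℝ). (This is the maximal Lie invariance algebra in the case b = r^{−2} f(φ).) -/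
noncomputable section

open Real Set

/-- The Lie bracket of vector fields on ℝ⁶ (identified with smooth maps),
`[X,Y](p) = DY(p)·X(p) − DX(p)·Y(p)`. -/
def lieVF (X Y : (Fin 6 → ℝ) → (Fin 6 → ℝ)) : (Fin 6 → ℝ) → (Fin 6 → ℝ) :=
  fun p => fderiv ℝ Y p (X p) - fderiv ℝ X p (Y p)

/-- `D(1) = ∂_t` on ℝ⁶ with coordinates `(t,x,y,u,v,h)`. -/
def D1 : (Fin 6 → ℝ) → (Fin 6 → ℝ) := fun _ => ![1, 0, 0, 0, 0, 0]

/-- `D(t) = t∂_t + ½x∂_x + ½y∂_y − ½u∂_u − ½v∂_v − h∂_h`. -/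
def Dt : (Fin 6 → ℝ) → (Fin 6 → ℝ) := fun p =>
  ![p 0, p 1 / 2, p 2 / 2, -(p 3) / 2, -(p 4) / 2, -(p 5)]

/-- `D(t²) = t²∂_t + tx∂_x + ty∂_y + (x − tu)∂_u + (y − tv)∂_v − 2th∂_h`. -/
def Dt2 : (Fin 6 → ℝ) → (Fin 6 → ℝ) := fun p =>
  ![(p 0) ^ 2, p 0 * p 1, p 0 * p 2, p 1 - p 0 * p 3, p 2 - p 0 * p 4, -(2 * p 0 * p 5)]

lemma differentiable_D1 : Differentiable ℝ D1 := differentiable_const _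

lemma differentiable_Dt : Differentiable ℝ Dt := by
  rw [differentiable_pi]
  intro i
  fin_cases i <;> simp [Dt] <;> fun_prop

lemma differentiable_Dt2 : Differentiable ℝ Dt2 := by
  rw [differentiable_pi]
  intro i
  fin_cases i <;> simp [Dt2] <;> fun_prop

lemma hasFDerivAt_coord (i : Fin 6) (p : Fin 6 → ℝ) :
    HasFDerivAt (fun q : Fin 6 → ℝ => q i) (ContinuousLinearMap.proj (R := ℝ) i) p :=
  hasFDerivAt_apply i p

lemma fderiv_D1_apply (p w : Fin 6 → ℝ) : fderiv ℝ D1 p w = 0 := by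
  have h : fderiv ℝ D1 p = 0 := fderiv_const_apply _
  simp [h]

lemma fderiv_Dt_apply (p w : Fin 6 → ℝ) : fderiv ℝ Dt p w = Dt w := by
  let L : (Fin 6 → ℝ) →ₗ[ℝ] (Fin 6 → ℝ) :=
    { toFun := Dt
      map_add' := fun p q => by
        ext i; fin_cases i <;> simp [Dt] <;> ring
      map_smul' := fun c p => by
        ext i; fin_cases i <;> simp [Dt] <;> ring }
  exact congrArg (fun T => T w) (LinearMap.toContinuousLinearMap L).fderiv

lemma fderiv_Dt2_apply (p w : Fin 6 → ℝ) :
    fderiv ℝ Dt2 p w =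
      ![2 * p 0 * w 0, p 0 * w 1 + p 1 * w 0, p 0 * w 2 + p 2 * w 0,
        w 1 - (p 0 * w 3 + p 3 * w 0), w 2 - (p 0 * w 4 + p 4 * w 0),
        -(2 * (p 0 * w 5 + p 5 * w 0))] := by
  have c := fun i => hasFDerivAt_coord i p
  ext i
  refine (congrArg (fun T => T w) (fderiv_apply (differentiable_Dt2 p) i)).symm.trans ?_
  fin_cases i
  · refine (congrArg (fun T => T w) ((c 0).pow 2).fderiv).trans ?_
    simp
  · refine (congrArg (fun T => T w) ((c 0).mul (c 1)).fderiv).trans ?_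
    simp
  · refine (congrArg (fun T => T w) ((c 0).mul (c 2)).fderiv).trans ?_
    simp
  · refine (congrArg (fun T => T w) ((c 1).sub ((c 0).mul (c 3))).fderiv).trans ?_
    simp
  · refine (congrArg (fun T => T w) ((c 2).sub ((c 0).mul (c 4))).fderiv).trans ?_
    simp
  · refine (congrArg (fun T => T w) (((c 0).const_mul 2).mul (c 5)).neg.fderiv).trans ?_
    simp
    ring

lemma fderiv_comb_apply (a b c : ℝ) (p w : Fin 6 → ℝ) :
    fderiv ℝ (a • D1 + b • Dt + c • Dt2) p w =
      b • fderiv ℝ Dt p w + c • fderiv ℝ Dt2 p w := by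
  have h := (((differentiable_D1 p).hasFDerivAt.const_smul a).add
    ((differentiable_Dt p).hasFDerivAt.const_smul b)).add
    ((differentiable_Dt2 p).hasFDerivAt.const_smul c)
  rw [h.fderiv]
  simp [fderiv_D1_apply]

/-- The bracket of two combinations of `D(1)`, `D(t)`, `D(t²)`. -/
lemma lieVF_comb (a b c a' b' c' : ℝ) :
    lieVF (a • D1 + b • Dt + c • Dt2) (a' • D1 + b' • Dt + c' • Dt2) =
      (a * b' - a' * b) • D1 + (2 * (a * c' - a' * c)) • Dt + (b * c' - b' * c) • Dt2 := by
  funext p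
  simp only [lieVF, fderiv_comb_apply, fderiv_Dt_apply, fderiv_Dt2_apply]
  ext i
  fin_cases i <;> simp [D1, Dt, Dt2] <;> ring

lemma comb_eq_zero {a b c : ℝ} (h : a • D1 + b • Dt + c • Dt2 = 0) :
    a = 0 ∧ b = 0 ∧ c = 0 := by
  have h0 := congrFun (congrFun h 0) 0
  have h1 := congrFun (congrFun h (fun _ => 1)) 0
  have h2 := congrFun (congrFun h (fun _ => -1)) 0
  simp [D1, Dt, Dt2] at h0 h1 h2
  refine ⟨h0, ?_, ?_⟩ <;> linarith

lemma mem_span_D {X : (Fin 6 → ℝ) → (Fin 6 → ℝ)} :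
    X ∈ Submodule.span ℝ {D1, Dt, Dt2} ↔
      ∃ a b c : ℝ, a • D1 + b • Dt + c • Dt2 = X :=
  Submodule.mem_span_triple

/-- The linear map `sl(2,ℝ) → span {D(1), D(t), D(t²)}` sending the standard basis `E, H, F` to
`D(1), -2 D(t), -D(t²)`. -/
def slToVF : LieAlgebra.SpecialLinear.sl (Fin 2) ℝ →ₗ[ℝ] Submodule.span ℝ {D1, Dt, Dt2} where
  toFun X := ⟨X.1 0 1 • D1 + (-2 * X.1 0 0) • Dt + (-X.1 1 0) • Dt2,
    mem_span_D.2 ⟨_, _, _, rfl⟩⟩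
  map_add' X Y := by
    ext1
    simp only [AddMemClass.coe_add, Matrix.add_apply]
    module
  map_smul' r X := by
    ext1
    simp only [SetLike.val_smul, Matrix.smul_apply, smul_eq_mul,
      RingHom.id_apply]
    module

lemma coe_slToVF (X : LieAlgebra.SpecialLinear.sl (Fin 2) ℝ) :
    (slToVF X : (Fin 6 → ℝ) → (Fin 6 → ℝ)) =
      X.1 0 1 • D1 + (-2 * X.1 0 0) • Dt + (-X.1 1 0) • Dt2 := rfl

lemma sl_two_apply_one_one (X : LieAlgebra.SpecialLinear.sl (Fin 2) ℝ) :
    X.1 1 1 = -X.1 0 0 := by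
  have h : Matrix.trace X.1 = 0 := LinearMap.mem_ker.1 X.2
  rw [Matrix.trace_fin_two] at h
  linarith

lemma slToVF_injective : Function.Injective slToVF := by
  rw [← LinearMap.ker_eq_bot, LinearMap.ker_eq_bot']
  intro X hX
  obtain ⟨h1, h2, h3⟩ := comb_eq_zero ((coe_slToVF X).symm.trans (congrArg Subtype.val hX))
  have h4 := sl_two_apply_one_one X
  ext i j
  fin_cases i <;> fin_cases j <;> simp <;> linarith

lemma slToVF_surjective : Function.Surjective slToVF := by
  rintro ⟨Y, hY⟩
  obtain ⟨a, b, c, rfl⟩ := mem_span_D.1 hY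
  refine ⟨⟨!![-b / 2, a; -c, b / 2], ?_⟩, ?_⟩
  · refine LinearMap.mem_ker.2 ((Matrix.trace_fin_two_of _ _ _ _).trans ?_)
    ring
  · ext1
    rw [coe_slToVF]
    simp only [Matrix.of_apply, Matrix.cons_val', Matrix.cons_val_zero, Matrix.cons_val_one,
      Matrix.cons_val_fin_one]
    module

lemma coe_slToVF_lie (X Y : LieAlgebra.SpecialLinear.sl (Fin 2) ℝ) :
    (slToVF ⁅X, Y⁆ : (Fin 6 → ℝ) → (Fin 6 → ℝ)) = lieVF (slToVF X) (slToVF Y) := by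
  rw [coe_slToVF, coe_slToVF, coe_slToVF, lieVF_comb]
  simp only [LieSubalgebra.coe_bracket, Ring.lie_def, Matrix.sub_apply, Matrix.mul_apply,
    Fin.sum_univ_two, sl_two_apply_one_one]
  module

/-- `D(1)`, `D(t)`, `D(t²)` are linearly independent, their span is closed
under the Lie bracket with `[D(1),D(t)] = D(1)`, `[D(1),D(t²)] = 2D(t)`,
`[D(t),D(t²)] = D(t²)`, and this three-dimensional Lie algebra is isomorphic to
`sl(2,ℝ)`. -/
theorem stmt_15 :
    LinearIndependent ℝ ![D1, Dt, Dt2] ∧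
    lieVF D1 Dt = D1 ∧
    lieVF D1 Dt2 = (2 : ℝ) • Dt ∧
    lieVF Dt Dt2 = Dt2 ∧
    (∀ X ∈ Submodule.span ℝ {D1, Dt, Dt2}, ∀ Y ∈ Submodule.span ℝ {D1, Dt, Dt2},
      lieVF X Y ∈ Submodule.span ℝ {D1, Dt, Dt2}) ∧
    ∃ e : ↥(LieAlgebra.SpecialLinear.sl (Fin 2) ℝ) ≃ₗ[ℝ]
        ↥(Submodule.span ℝ {D1, Dt, Dt2}),
      ∀ X Y : ↥(LieAlgebra.SpecialLinear.sl (Fin 2) ℝ),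
        (↑(e ⁅X, Y⁆) : (Fin 6 → ℝ) → (Fin 6 → ℝ)) = lieVF ↑(e X) ↑(e Y) := by
  refine ⟨?_, ?_, ?_, ?_, ?_, LinearEquiv.ofBijective slToVF ⟨slToVF_injective, slToVF_surjective⟩,
    coe_slToVF_lie⟩
  · rw [Fintype.linearIndependent_iff]
    intro g hg
    simp only [Fin.sum_univ_three, Matrix.cons_val] at hg
    obtain ⟨h0, h1, h2⟩ := comb_eq_zero hg
    intro i
    fin_cases i <;> assumption
  · simpa using lieVF_comb 1 0 0 0 1 0
  · simpa using lieVF_comb 1 0 0 0 0 1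
  · simpa using lieVF_comb 0 1 0 0 0 1
  · intro X hX Y hY
    obtain ⟨a, b, c, rfl⟩ := mem_span_D.1 hX
    obtain ⟨a', b', c', rfl⟩ := mem_span_D.1 hY
    exact mem_span_D.2 ⟨_, _, _, (lieVF_comb a b c a' b' c').symm⟩
end
end

section
/- Let 0 < β < 1 and set (a,b,c,d) = (½(1−β), ½(1+β), ½(1+β), ½(1−β)). On ℝ⁶ with coordinates (t,x,y,u,v,h), the six vector fields e₁ = P(0, e^{βt}), e₂ = P(0, e^{−βt}), e₃ = P(e^{t}, 0), e₄ = P(e^{−t}, 0), e₅ = ½Dˢ + ½D(1), e₆ = ½Dˢ − ½D(1) are linearly independent and satisfy exactly the following nonzero Lie-bracket relations (up to antisymmetry): [e₁,e₅] = a·e₁, [e₂,e₅] = b·e₂, [e₄,e₅] = e₄, [e₁,e₆] = c·e₁, [e₂,e₆] = d·e₂, [e₃,e₆] = e₃; all other brackets among e₁,…,e₆ vanish. In particular their span is a six-dimensional solvable Lie algebra isomorphic to the Turkowski algebra N₆.₁ with parameters (a,b,c,d). (This identifies the maximal Lie invariance algebra of the case b = ½x² + ½β²y².) -/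
noncomputable section

open Real Set

/-- `e₁ = P(0, e^{βt})` on ℝ⁶ with coordinates `(t,x,y,u,v,h)`. -/
def E1 (β : ℝ) : (Fin 6 → ℝ) → (Fin 6 → ℝ) := fun p =>
  ![0, 0, Real.exp (β * p 0), 0, β * Real.exp (β * p 0), 0]

/-- `e₂ = P(0, e^{−βt})`. -/
def E2 (β : ℝ) : (Fin 6 → ℝ) → (Fin 6 → ℝ) := fun p =>
  ![0, 0, Real.exp (-(β * p 0)), 0, -(β * Real.exp (-(β * p 0))), 0]

/-- `e₃ = P(e^t, 0)`. -/
def E3 : (Fin 6 → ℝ) → (Fin 6 → ℝ) := fun p =>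
  ![0, Real.exp (p 0), 0, Real.exp (p 0), 0, 0]

/-- `e₄ = P(e^{−t}, 0)`. -/
def E4 : (Fin 6 → ℝ) → (Fin 6 → ℝ) := fun p =>
  ![0, Real.exp (-(p 0)), 0, -(Real.exp (-(p 0))), 0, 0]

/-- `e₅ = ½Dˢ + ½D(1)`. -/
def E5 : (Fin 6 → ℝ) → (Fin 6 → ℝ) := fun p =>
  ![1 / 2, p 1 / 2, p 2 / 2, p 3 / 2, p 4 / 2, p 5]

/-- `e₆ = ½Dˢ − ½D(1)`. -/
def E6 : (Fin 6 → ℝ) → (Fin 6 → ℝ) := fun p =>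
  ![-(1 / 2), p 1 / 2, p 2 / 2, p 3 / 2, p 4 / 2, p 5]

/-- The bracket of the Turkowski algebra `N₆.₁^{abcd}` on basis coordinates:
nonzero relations `[e₁,e₅]=ae₁`, `[e₂,e₅]=be₂`, `[e₄,e₅]=e₄`, `[e₁,e₆]=ce₁`,
`[e₂,e₆]=de₂`, `[e₃,e₆]=e₃`, extended bilinearly. -/
def brN (a b c d : ℝ) (x y : Fin 6 → ℝ) : Fin 6 → ℝ :=
  ![a * (x 0 * y 4 - x 4 * y 0) + c * (x 0 * y 5 - x 5 * y 0),
    b * (x 1 * y 4 - x 4 * y 1) + d * (x 1 * y 5 - x 5 * y 1),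
    x 2 * y 5 - x 5 * y 2,
    x 3 * y 4 - x 4 * y 3,
    0, 0]

/-- The linear combination of `e₁,…,e₆` with coefficients `x`. -/
def combVF (β : ℝ) : (Fin 6 → ℝ) →ₗ[ℝ] ((Fin 6 → ℝ) → (Fin 6 → ℝ)) :=
  Fintype.linearCombination ℝ ![E1 β, E2 β, E3, E4, E5, E6]

lemma combVF_apply (β : ℝ) (x p : Fin 6 → ℝ) :
    combVF β x p =
      ![(x 4 - x 5) / 2,
        x 2 * Real.exp (p 0) + x 3 * Real.exp (-(p 0)) + (x 4 + x 5) / 2 * p 1,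
        x 0 * Real.exp (β * p 0) + x 1 * Real.exp (-(β * p 0)) + (x 4 + x 5) / 2 * p 2,
        x 2 * Real.exp (p 0) - x 3 * Real.exp (-(p 0)) + (x 4 + x 5) / 2 * p 3,
        β * (x 0 * Real.exp (β * p 0) - x 1 * Real.exp (-(β * p 0))) + (x 4 + x 5) / 2 * p 4,
        (x 4 + x 5) * p 5] := by
  ext i
  fin_cases i <;>
    simp [combVF, Fintype.linearCombination_apply, Fin.sum_univ_succ, E1, E2, E3, E4, E5, E6] <;>
    ring

lemma fderiv_combVF (β : ℝ) (x p q : Fin 6 → ℝ) :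
    fderiv ℝ (combVF β x) p q =
      ![0,
        (x 2 * Real.exp (p 0) - x 3 * Real.exp (-(p 0))) * q 0 + (x 4 + x 5) / 2 * q 1,
        β * (x 0 * Real.exp (β * p 0) - x 1 * Real.exp (-(β * p 0))) * q 0 +
          (x 4 + x 5) / 2 * q 2,
        (x 2 * Real.exp (p 0) + x 3 * Real.exp (-(p 0))) * q 0 + (x 4 + x 5) / 2 * q 3,
        β ^ 2 * (x 0 * Real.exp (β * p 0) + x 1 * Real.exp (-(β * p 0))) * q 0 +
          (x 4 + x 5) / 2 * q 4,
        (x 4 + x 5) * q 5] := by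
  set D : Fin 6 → ℝ := ![0,
        (x 2 * Real.exp (p 0) - x 3 * Real.exp (-(p 0))) * q 0 + (x 4 + x 5) / 2 * q 1,
        β * (x 0 * Real.exp (β * p 0) - x 1 * Real.exp (-(β * p 0))) * q 0 +
          (x 4 + x 5) / 2 * q 2,
        (x 2 * Real.exp (p 0) + x 3 * Real.exp (-(p 0))) * q 0 + (x 4 + x 5) / 2 * q 3,
        β ^ 2 * (x 0 * Real.exp (β * p 0) + x 1 * Real.exp (-(β * p 0))) * q 0 +
          (x 4 + x 5) / 2 * q 4,
        (x 4 + x 5) * q 5]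
  have hp (i : Fin 6) : HasFDerivAt (fun r : Fin 6 → ℝ => r i)
      (ContinuousLinearMap.proj (R := ℝ) (φ := fun _ : Fin 6 => ℝ) i) p := hasFDerivAt_apply i p
  have h₁ := (hp 0).exp
  have h₂ := (hp 0).neg.exp
  have h₃ := ((hp 0).const_mul β).exp
  have h₄ := ((hp 0).const_mul β).neg.exp
  have lin (k : ℝ) (i : Fin 6) := (hp i).const_mul k
  have key (i : Fin 6) : ∃ L : (Fin 6 → ℝ) →L[ℝ] ℝ,
      HasFDerivAt (fun r => combVF β x r i) L p ∧ L q = D i := by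
    simp only [combVF_apply]
    fin_cases i
    · exact ⟨_, hasFDerivAt_const ((x 4 - x 5) / 2) p, by simp [D]⟩
    · exact ⟨_, ((h₁.const_mul (x 2)).add (h₂.const_mul (x 3))).add (lin ((x 4 + x 5) / 2) 1),
        by simp [D]; ring⟩
    · exact ⟨_, ((h₃.const_mul (x 0)).add (h₄.const_mul (x 1))).add (lin ((x 4 + x 5) / 2) 2),
        by simp [D]; ring⟩
    · exact ⟨_, ((h₁.const_mul (x 2)).sub (h₂.const_mul (x 3))).add (lin ((x 4 + x 5) / 2) 3),
        by simp [D]; ring⟩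
    · exact ⟨_, (((h₃.const_mul (x 0)).sub (h₄.const_mul (x 1))).const_mul β).add
        (lin ((x 4 + x 5) / 2) 4), by simp [D]; ring⟩
    · exact ⟨_, lin (x 4 + x 5) 5, by simp [D]⟩
  choose L hL hLq using key
  rw [(hasFDerivAt_pi.2 hL).fderiv]
  exact funext hLq

lemma lieVF_combVF (β : ℝ) (x y : Fin 6 → ℝ) :
    lieVF (combVF β x) (combVF β y) =
      combVF β (brN ((1 - β) / 2) ((1 + β) / 2) ((1 + β) / 2) ((1 - β) / 2) x y) := by
  funext p
  simp only [lieVF, fderiv_combVF]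
  ext i
  fin_cases i <;> simp [combVF_apply, brN] <;> ring

lemma combVF_injective {β : ℝ} (hβ : β ≠ 0) : Function.Injective (combVF β) := by
  rw [← LinearMap.ker_eq_bot, LinearMap.ker_eq_bot']
  intro x hx
  have h (p : Fin 6 → ℝ) (i : Fin 6) : combVF β x p i = 0 := by rw [hx]; rfl
  have h₀ := h 0 0
  have h₁ := h 0 1
  have h₂ := h 0 2
  have h₃ := h 0 3
  have h₄ := h 0 4
  have h₅ := h 1 5
  simp [combVF_apply, hβ] at h₀ h₁ h₂ h₃ h₄ h₅
  ext i
  fin_cases i <;> simp <;> linarith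

lemma range_combVF (β : ℝ) :
    LinearMap.range (combVF β) = Submodule.span ℝ {E1 β, E2 β, E3, E4, E5, E6} := by
  rw [combVF, Fintype.range_linearCombination]
  congr 1
  simp only [Matrix.range_cons, Matrix.range_empty, Set.union_empty, Set.singleton_union]

lemma combVF_single (β : ℝ) (i : Fin 6) :
    combVF β (Pi.single i 1) = ![E1 β, E2 β, E3, E4, E5, E6] i := by
  simp [combVF, Fintype.linearCombination_apply_single]

/-- for `0 < β < 1` and `(a,b,c,d) = ½(1−β, 1+β, 1+β, 1−β)`, the six vector
fields `e₁,…,e₆` are linearly independent, satisfy exactly the nonzero bracket relations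
of the Turkowski algebra `N₆.₁^{abcd}` (all other brackets vanishing), and their span is
a six-dimensional Lie algebra isomorphic to `N₆.₁^{abcd}`. -/
theorem stmt_17 (β : ℝ) (hβ : 0 < β ∧ β < 1)
    (a b c d : ℝ)
    (habcd : a = (1 - β) / 2 ∧ b = (1 + β) / 2 ∧ c = (1 + β) / 2 ∧ d = (1 - β) / 2) :
    LinearIndependent ℝ ![E1 β, E2 β, E3, E4, E5, E6] ∧
    (lieVF (E1 β) E5 = a • E1 β ∧ lieVF (E2 β) E5 = b • E2 β ∧ lieVF E4 E5 = E4 ∧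
     lieVF (E1 β) E6 = c • E1 β ∧ lieVF (E2 β) E6 = d • E2 β ∧ lieVF E3 E6 = E3) ∧
    (lieVF (E1 β) (E2 β) = 0 ∧ lieVF (E1 β) E3 = 0 ∧ lieVF (E1 β) E4 = 0 ∧
     lieVF (E2 β) E3 = 0 ∧ lieVF (E2 β) E4 = 0 ∧ lieVF E3 E4 = 0 ∧
     lieVF E3 E5 = 0 ∧ lieVF E4 E6 = 0 ∧ lieVF E5 E6 = 0) ∧
    (∀ X ∈ Submodule.span ℝ {E1 β, E2 β, E3, E4, E5, E6},
      ∀ Y ∈ Submodule.span ℝ {E1 β, E2 β, E3, E4, E5, E6},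
        lieVF X Y ∈ Submodule.span ℝ {E1 β, E2 β, E3, E4, E5, E6}) ∧
    ∃ e : (Fin 6 → ℝ) ≃ₗ[ℝ] ↥(Submodule.span ℝ {E1 β, E2 β, E3, E4, E5, E6}),
      ∀ x y : Fin 6 → ℝ,
        (↑(e (brN a b c d x y)) : (Fin 6 → ℝ) → (Fin 6 → ℝ)) = lieVF ↑(e x) ↑(e y) := by
  obtain ⟨hβ₀, -⟩ := hβ
  obtain ⟨rfl, rfl, rfl, rfl⟩ := habcd
  have hinj := combVF_injective hβ₀.ne'
  have s₁ : E1 β = combVF β (Pi.single 0 1) := (combVF_single β 0).symm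
  have s₂ : E2 β = combVF β (Pi.single 1 1) := (combVF_single β 1).symm
  have s₃ : E3 = combVF β (Pi.single 2 1) := (combVF_single β 2).symm
  have s₄ : E4 = combVF β (Pi.single 3 1) := (combVF_single β 3).symm
  have s₅ : E5 = combVF β (Pi.single 4 1) := (combVF_single β 4).symm
  have s₆ : E6 = combVF β (Pi.single 5 1) := (combVF_single β 5).symm
  refine ⟨linearIndependent_iff_injective_fintypeLinearCombination.2 hinj, ?_, ?_, ?_, ?_⟩
  · rw [s₁, s₂, s₃, s₄, s₅, s₆]
    simp only [lieVF_combVF, ← map_smul]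
    refine ⟨?_, ?_, ?_, ?_, ?_, ?_⟩ <;> congr 1 <;> ext i <;> fin_cases i <;> simp [brN]
  · rw [s₁, s₂, s₃, s₄, s₅, s₆]
    simp only [lieVF_combVF, ← map_zero (combVF β)]
    refine ⟨?_, ?_, ?_, ?_, ?_, ?_, ?_, ?_, ?_⟩ <;> congr 1 <;> ext i <;> fin_cases i <;>
      simp [brN]
  · rw [← range_combVF]
    rintro _ ⟨x, rfl⟩ _ ⟨y, rfl⟩
    exact ⟨_, (lieVF_combVF β x y).symm⟩
  · rw [← range_combVF]
    exact ⟨LinearEquiv.ofInjective (combVF β) hinj, fun x y => (lieVF_combVF β x y).symm⟩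
end
end
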